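/- Let C be an endomorphism of V that is semisimple (diagonalizable) and preserves each graded piece, i.e. C(V_k) ⊆ V_k for all k ∈ ℤ, and let Nʹ be an endomorphism of V that strictly lowers the filtration, i.e. Nʹ(V^{(k)}) ⊆ V^{(k−1)} for all k ∈ ℤ. Suppose C + Nʹ = S + M where S is a semisimple endomorphism, M is a nilpotent endomorphism, and S ∘ M = M ∘ S (the Jordan–Chevalley decomposition of C + Nʹ). Then both S − C and M strictly lower the filtration: (S − C)(V^{(k)}) ⊆ V^{(k−1)} and M(V^{(k)}) ⊆ V^{(k−1)} for all k ∈ ℤ. -/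

import Mathlib

noncomputable section

open Polynomial in
/-- If `f` and `g` preserve a filtration and `f - g` strictly lowers it, then so does
`p(f) - p(g)` for every polynomial `p`. -/
lemma aeval_sub_aeval_lowers_filtration {K V : Type*} [Field K] [AddCommGroup V] [Module K V]
    {F : ℤ → Submodule K V} {f g : Module.End K V}
    (hf : ∀ k, ∀ v ∈ F k, f v ∈ F k) (hg : ∀ k, ∀ v ∈ F k, g v ∈ F k)
    (hfg : ∀ k, ∀ v ∈ F k, (f - g) v ∈ F (k - 1)) (p : K[X]) :
    ∀ k, ∀ v ∈ F k, (aeval f p - aeval g p) v ∈ F (k - 1) := by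
  have hpow : ∀ n : ℕ, ∀ k, ∀ v ∈ F k, (f ^ n - g ^ n) v ∈ F (k - 1) := by
    intro n
    induction n with
    | zero => simp
    | succ n ih =>
      intro k v hv
      have h : f ^ (n + 1) - g ^ (n + 1) = f * (f ^ n - g ^ n) + (f - g) * g ^ n := by
        rw [pow_succ', pow_succ']; noncomm_ring
      have hgn : (g ^ n) v ∈ F k := by
        rw [Module.End.pow_apply]
        exact Set.MapsTo.iterate (s := (F k : Set V)) (hg k) n hv
      rw [h]
      exact add_mem (hf _ _ (ih k v hv)) (hfg k _ hgn)
  induction p using Polynomial.induction_on' with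
  | add p q hp hq =>
    intro k v hv
    have h : aeval f (p + q) - aeval g (p + q)
        = (aeval f p - aeval g p) + (aeval f q - aeval g q) := by
      rw [map_add, map_add]; abel
    rw [h]
    exact add_mem (hp k v hv) (hq k v hv)
  | monomial n a =>
    intro k v hv
    have h : aeval f (monomial n a) - aeval g (monomial n a) = a • (f ^ n - g ^ n) := by
      simp [aeval_monomial, mul_sub, Algebra.smul_def]
    rw [h]
    exact (F _).smul_mem a (hpow n k v hv)

/-- An endomorphism strictly lowering a bounded exhaustive filtration is nilpotent. -/
lemma isNilpotent_of_lowers_filtration {K V : Type*} [Field K] [AddCommGroup V] [Module K V]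
    {F : ℤ → Submodule K V} {f : Module.End K V} (hf : ∀ k, ∀ v ∈ F k, f v ∈ F (k - 1))
    {a b : ℤ} (ha : ∀ k ≤ a, F k = ⊥) (hb : F b = ⊤) : IsNilpotent f := by
  have hpow : ∀ n : ℕ, ∀ v, (f ^ n) v ∈ F (b - n) := by
    intro n
    induction n with
    | zero => simp [hb]
    | succ n ih =>
      intro v
      rw [pow_succ']
      have h := hf _ _ (ih v)
      rwa [sub_sub, ← Nat.cast_succ] at h
  refine ⟨(b - a).toNat, LinearMap.ext fun v => ?_⟩
  have h := hpow (b - a).toNat v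
  rwa [ha _ (by omega), Submodule.mem_bot] at h

/-- Let `V` be a finite-dimensional complex vector space with a
`ℤ`-grading `V = ⊕ Vg k` and associated increasing filtration `F k = ⊕_{j ≤ k} Vg j`.
If `C` is semisimple and preserves each graded piece, `Nn` strictly lowers the
filtration, and `C + Nn = S + M` is the Jordan–Chevalley decomposition (`S`
semisimple, `M` nilpotent, `S` and `M` commuting), then both `S - C` and `M`
strictly lower the filtration. -/
theorem jordan_part_lowers_filtration
    {V : Type*} [AddCommGroup V] [Module ℂ V] [FiniteDimensional ℂ V]
    (Vg : ℤ → Submodule ℂ V) (hgr : DirectSum.IsInternal Vg)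
    (hfin : {k : ℤ | Vg k ≠ ⊥}.Finite)
    (F : ℤ → Submodule ℂ V) (hF : ∀ k, F k = ⨆ j ≤ k, Vg j)
    (C Nn S M : Module.End ℂ V)
    (hC : C.IsSemisimple)
    (hCgr : ∀ k, ∀ v ∈ Vg k, C v ∈ Vg k)
    (hNn : ∀ k, ∀ v ∈ F k, Nn v ∈ F (k - 1))
    (hsum : C + Nn = S + M)
    (hS : S.IsSemisimple) (hM : IsNilpotent M) (hSM : Commute S M) :
    (∀ k, ∀ v ∈ F k, (S - C) v ∈ F (k - 1)) ∧ (∀ k, ∀ v ∈ F k, M v ∈ F (k - 1)) := by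
  have hmono : Monotone F := fun k l hkl => by
    rw [hF, hF]
    exact biSup_mono fun j hj => hj.trans hkl
  have hCF : ∀ k, ∀ v ∈ F k, C v ∈ F k := by
    intro k
    change F k ≤ (F k).comap C
    conv_lhs => rw [hF]
    refine iSup₂_le fun j hj v hv => ?_
    rw [Submodule.mem_comap, hF]
    exact le_iSup₂ (f := fun j (_ : j ≤ k) => Vg j) j hj (hCgr j v hv)
  have hAF : ∀ k, ∀ v ∈ F k, (C + Nn) v ∈ F k := fun k v hv =>
    add_mem (hCF k v hv) (hmono (by omega) (hNn k v hv))
  obtain ⟨b, hb⟩ := hfin.bddAbove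
  obtain ⟨a, ha⟩ := hfin.bddBelow
  have hbot : ∀ k ≤ a - 1, F k = ⊥ := by
    intro k hk
    rw [hF, iSup₂_eq_bot]
    intro j hj
    by_contra h
    have := ha h
    omega
  have htop : F b = ⊤ := by
    rw [hF, eq_top_iff, ← hgr.submodule_iSup_eq_top]
    refine iSup_le fun j => ?_
    by_cases h : Vg j = ⊥
    · simp [h]
    · exact le_iSup₂ (f := fun j (_ : j ≤ b) => Vg j) j (hb h)
  have hMadj : M ∈ Algebra.adjoin ℂ {C + Nn} := by
    obtain ⟨n, hn, s, hs, hnil, hss, h⟩ := (C + Nn).exists_isNilpotent_isSemisimple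
    have hcomm : Commute n s :=
      Algebra.commute_of_mem_adjoin_of_forall_mem_commute hs fun x hx => by
        rw [Set.mem_singleton_iff.mp hx]
        exact (Algebra.commute_of_mem_adjoin_self hn).symm
    have hnM : n = M := (Module.End.isNilpotent_isSemisimple_unique hnil hss hM hS hcomm
      hSM.symm (by rw [← h, hsum, add_comm])).1
    exact hnM ▸ hn
  rw [Algebra.adjoin_singleton_eq_range_aeval] at hMadj
  obtain ⟨q, hq⟩ := hMadj
  replace hq : Polynomial.aeval (C + Nn) q = M := hq
  have hlow := aeval_sub_aeval_lowers_filtration hAF hCF (by simpa using hNn)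
  have hqC : Polynomial.aeval C q = 0 := by
    obtain ⟨n, hn⟩ := hM
    refine Module.End.eq_zero_of_isNilpotent_isSemisimple ?_ (hC.aeval q)
    refine IsNilpotent.of_pow (m := n)
      (isNilpotent_of_lowers_filtration (fun k v hv => ?_) hbot htop)
    have h := hlow (q ^ n) k v hv
    rw [map_pow, map_pow, hq, hn, zero_sub, LinearMap.neg_apply] at h
    exact neg_mem_iff.mp h
  have hMF : ∀ k, ∀ v ∈ F k, M v ∈ F (k - 1) := by
    simpa only [hq, hqC, sub_zero] using hlow q
  refine ⟨fun k v hv => ?_, hMF⟩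
  have h : S - C = Nn - M := by
    rw [sub_eq_sub_iff_add_eq_add, ← hsum, add_comm]
  rw [h]
  exact sub_mem (hNn k v hv) (hMF k v hv)
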